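/- arXiv:1504.00868 — 7 statements merged into one kernel-verified Lean document; each statement's English description precedes it below -/
import Mathlib

section
/- Nye's formula: let Ω ⊆ ℝ³ be open and let Ā : Ω → Matrix (Fin 3) (Fin 3) ℝ be a C¹ matrix field such that Ā(x) is skew-symmetric for every x ∈ Ω. Then on Ω one has −Curl Ā = (∇(axl Ā))ᵀ − tr((∇(axl Ā))ᵀ)·1, or equivalently ∇(axl Ā) = −(Curl Ā)ᵀ + (1/2)·tr((Curl Ā)ᵀ)·1. -/
open Matrix MeasureTheory

noncomputable section

abbrev V3 : Type := Fin 3 → ℝ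
abbrev M3 : Type := Matrix (Fin 3) (Fin 3) ℝ

/-- Partial derivative `∂ⱼ f`. -/
def pd (j : Fin 3) (f : V3 → ℝ) (x : V3) : ℝ := fderiv ℝ f x (Pi.single j 1)

/-- Levi-Civita symbol `ε i j k`. -/
def lc (i j k : Fin 3) : ℝ :=
  ((j.val : ℝ) - i.val) * ((k.val : ℝ) - j.val) * ((k.val : ℝ) - i.val) / 2

/-- Gradient (Jacobian) of a vector field: `(∇u)ᵢⱼ = ∂ⱼ uᵢ`. -/
def grad (u : V3 → V3) (x : V3) : M3 := Matrix.of fun i j => pd j (fun y => u y i) x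

/-- curl of a vector field: `(curl u)ᵢ = ε i j k ∂ⱼ uₖ`. -/
def vcurl (u : V3 → V3) (x : V3) : V3 := fun i => ∑ j, ∑ k, lc i j k * pd j (fun y => u y k) x

/-- divergence of a vector field. -/
def vdiv (u : V3 → V3) (x : V3) : ℝ := ∑ i, pd i (fun y => u y i) x

/-- Row-wise Curl of a matrix field: `(Curl P)ᵢⱼ = ε j k l ∂ₖ P i l`. -/
def mCurl (P : V3 → M3) (x : V3) : M3 :=
  Matrix.of fun i j => ∑ k, ∑ l, lc j k l * pd k (fun y => P y i l) x

/-- Row-wise divergence of a matrix field: `(Div P)ᵢ = ∂ⱼ P i j`. -/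
def mDiv (P : V3 → M3) (x : V3) : V3 := fun i => ∑ j, pd j (fun y => P y i j) x

/-- Symmetric part of a matrix. -/
def symM (X : M3) : M3 := (1/2 : ℝ) • (X + Xᵀ)

/-- Skew-symmetric part of a matrix. -/
def skewM (X : M3) : M3 := (1/2 : ℝ) • (X - Xᵀ)

/-- Deviatoric (trace-free) part of a matrix. -/
def devM (X : M3) : M3 := X - (Matrix.trace X / 3) • (1 : M3)

/-- The axial vector of a (skew-symmetric) matrix: `axl Ā = (Ā₃₂, Ā₁₃, Ā₂₁)`. -/
def axl (X : M3) : V3 := ![X 2 1, X 0 2, X 1 0]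

/-- `(anti v)ᵢⱼ = -ε i j k vₖ`. -/
def antiV (v : V3) : M3 := Matrix.of fun i j => -∑ k, lc i j k * v k

/-- Cross product on `ℝ³`. -/
def cross3 (a b : V3) : V3 := fun i => ∑ j, ∑ k, lc i j k * a j * b k

/-- Euclidean inner product on `ℝ³`. -/
def dot3 (a b : V3) : ℝ := ∑ i, a i * b i

/-- Squared Frobenius norm of a matrix. -/
def frob2 (X : M3) : ℝ := ∑ i, ∑ j, (X i j) ^ 2

/-- On an open set where `A` is skew-symmetric, so are its partial derivatives. -/
theorem pd_skew {Ω : Set V3} (hΩ : IsOpen Ω) {A : V3 → M3}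
    (hskew : ∀ x ∈ Ω, (A x)ᵀ = -(A x)) {x : V3} (hx : x ∈ Ω) (k i j : Fin 3) :
    pd k (fun y => A y i j) x = -pd k (fun y => A y j i) x := by
  have h : (fun y => A y i j) =ᶠ[nhds x] fun y => -A y j i := by
    filter_upwards [hΩ.mem_nhds hx] with y hy
    exact congrFun (congrFun (hskew y hy) j) i
  unfold pd
  rw [h.fderiv_eq, fderiv_fun_neg, _root_.neg_apply]

/-- Nye's formula for a C¹ skew-symmetric matrix field on an open set `Ω ⊆ ℝ³`. -/
theorem nye_formula (Ω : Set V3) (hΩ : IsOpen Ω)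
    (A : V3 → M3) (hA : ∀ i j, ContDiffOn ℝ 1 (fun y => A y i j) Ω)
    (hskew : ∀ x ∈ Ω, (A x)ᵀ = -(A x)) :
    (∀ x ∈ Ω,
       -(mCurl A x)
         = (grad (fun y => axl (A y)) x)ᵀ
           - Matrix.trace ((grad (fun y => axl (A y)) x)ᵀ) • (1 : M3)) ∧
    (∀ x ∈ Ω,
       grad (fun y => axl (A y)) x
         = -((mCurl A x)ᵀ) + ((1/2 : ℝ) * Matrix.trace ((mCurl A x)ᵀ)) • (1 : M3)) := by
  constructor <;> intro x hx <;>
  · have hs := pd_skew hΩ hskew hx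
    have hd : ∀ k i, pd k (fun y => A y i i) x = 0 := fun k i => by linarith [hs k i i]
    have h01 := fun k => hs k 0 1
    have h20 := fun k => hs k 2 0
    have h12 := fun k => hs k 1 2
    ext i j
    fin_cases i <;> fin_cases j <;>
      simp [mCurl, grad, axl, lc, Matrix.trace, Fin.sum_univ_three, hd, h01, h20, h12] <;>
      ring
end
end

section
/- Let Ω ⊆ ℝ³ be an open, connected and simply connected set and let p : Ω → Matrix (Fin 3) (Fin 3) ℝ be a C¹ matrix field. Then the identity ∇(axl(skew p)) = (Curl(sym p))ᵀ holds on Ω if and only if there exists a map u : Ω → ℝ³ of class C² such that p = ∇u on Ω. -/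
open Matrix MeasureTheory

noncomputable section

/-- On a simply connected, locally path-connected space, locally defined functions that differ
by locally constant functions on overlaps glue to a global function, up to locally constant
functions. -/
theorem exists_glue_of_sub_locallyConstant {X G : Type*} [TopologicalSpace X]
    [SimplyConnectedSpace X] [LocallyPathConnectedSpace X] [AddCommGroup G]
    (U : X → Set X) (hU : ∀ i, IsOpen (U i)) (hmem : ∀ i, i ∈ U i) (f : X → X → G)
    (hf : ∀ i j, ∀ x ∈ U i ∩ U j, ∀ᶠ y in nhds x, f i y - f j y = f i x - f j x) :
    ∃ g : X → G, ∀ i, ∀ᶠ y in nhds i, g y - f i y = g i - f i i := by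
  let _ : TopologicalSpace G := ⊥
  have : DiscreteTopology G := ⟨rfl⟩
  let Z : FiberBundleCore X X G :=
    { baseSet := U
      isOpen_baseSet := hU
      indexAt := id
      mem_baseSet_at := hmem
      coordChange := fun i j x v => v + (f i x - f j x)
      coordChange_self := by simp
      continuousOn_coordChange := by
        rintro i j ⟨x, v⟩ ⟨hx, -⟩
        refine ContinuousAt.continuousWithinAt ?_
        refine continuousAt_snd.add
          ((continuousAt_const (y := f i x - f j x)).congr ?_)
        filter_upwards [continuousAt_fst.eventually (hf i j x hx)] with y hy using hy.symm
      coordChange_comp := by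
        intros
        abel }
  have cov : IsCoveringMap (Bundle.TotalSpace.proj : Z.TotalSpace → X) :=
    FiberBundle.isCoveringMap (F := G) (E := Z.Fiber)
  obtain ⟨x₀⟩ := PathConnectedSpace.nonempty (X := X)
  obtain ⟨s, ⟨-, hs⟩, -⟩ := cov.existsUnique_continuousMap_lifts (ContinuousMap.id X) x₀
    (⟨x₀, (0 : G)⟩ : Z.TotalSpace) rfl
  have hs' (x : X) : (s x).proj = x := congrFun hs x
  refine ⟨fun x => (show G from (s x).2) + f x x, fun i => ?_⟩
  have hsrc : s i ∈ (Z.localTriv i).source := by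
    rw [Z.mem_localTriv_source, hs']
    exact hmem i
  have hc : ContinuousAt (fun y => (Z.localTriv i (s y)).2) i :=
    continuousAt_snd.comp
      (((Z.localTriv i).continuousAt hsrc).comp (f := s) s.continuous.continuousAt)
  have key (y : X) :
      (Z.localTriv i (s y)).2 = (show G from (s y).2) + (f y y - f i y) := by
    change (show G from (s y).2) + (f (s y).proj (s y).proj - f i (s y).proj) = _
    rw [hs' y]
  have hd : ∀ᶠ y in nhds i, (Z.localTriv i (s y)).2 = (Z.localTriv i (s i)).2 :=
    hc.eventually (p := (· = (Z.localTriv i (s i)).2)) (by rw [nhds_discrete]; exact rfl)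
  filter_upwards [hd] with y hy
  rw [key, key] at hy
  exact (add_sub_assoc _ _ _).trans (hy.trans (add_sub_assoc _ _ _).symm)

/-- Poincaré lemma for `1`-forms on a simply connected open set. -/
theorem exists_hasFDerivAt_of_fderiv_symmetric_of_simplyConnected {E F : Type*}
    [NormedAddCommGroup E] [NormedSpace ℝ E] [NormedAddCommGroup F] [NormedSpace ℝ F]
    [CompleteSpace F] {Ω : Set E} (hΩ : IsOpen Ω) [SimplyConnectedSpace Ω]
    {ω : E → E →L[ℝ] F} (hω : DifferentiableOn ℝ ω Ω)
    (hsymm : ∀ x ∈ Ω, ∀ a b, fderiv ℝ ω x a b = fderiv ℝ ω x b a) :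
    ∃ g : E → F, ∀ x ∈ Ω, HasFDerivAt g (ω x) x := by
  have : LocallyPathConnectedSpace Ω := hΩ.locallyPathConnectedSpace
  have hloc : ∀ i : Ω, ∃ r > 0, Metric.ball (i : E) r ⊆ Ω ∧
      ∃ f : E → F, ∀ x ∈ Metric.ball (i : E) r, HasFDerivAt f (ω x) x := by
    intro i
    obtain ⟨r, hr, hrΩ⟩ := Metric.isOpen_iff.1 hΩ i i.2
    exact ⟨r, hr, hrΩ, (convex_ball (i : E) r).exists_forall_hasFDerivAt_of_fderiv_symmetric
      Metric.isOpen_ball (hω.mono hrΩ) fun x hx a b => hsymm x (hrΩ hx) a b⟩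
  choose r hr hrΩ f hf using hloc
  obtain ⟨g, hg⟩ := exists_glue_of_sub_locallyConstant
    (fun i : Ω => Subtype.val ⁻¹' Metric.ball (i : E) (r i))
    (fun i => Metric.isOpen_ball.preimage continuous_subtype_val)
    (fun i => Metric.mem_ball_self (hr i)) (fun i x => f i x) (by
      rintro i j x ⟨hxi, hxj⟩
      have hO : IsOpen (Metric.ball (i : E) (r i) ∩ Metric.ball (j : E) (r j)) :=
        Metric.isOpen_ball.inter Metric.isOpen_ball
      filter_upwards [(hO.preimage continuous_subtype_val).mem_nhds ⟨hxi, hxj⟩] with y hy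
      have hd : ∀ z ∈ Metric.ball (i : E) (r i) ∩ Metric.ball (j : E) (r j),
          HasFDerivAt (fun z => f i z - f j z) (0 : E →L[ℝ] F) z := fun z hz => by
        simpa using (hf i z hz.1).fun_sub (hf j z hz.2)
      exact ((convex_ball _ _).inter (convex_ball _ _)).is_const_of_fderivWithin_eq_zero (𝕜 := ℝ)
        (fun z hz => (hd z hz).differentiableAt.differentiableWithinAt)
        (fun z hz => by
          rw [fderivWithin_of_isOpen hO hz]
          exact (hd z hz).fderiv) hy ⟨hxi, hxj⟩)
  classical
  refine ⟨fun x => if h : x ∈ Ω then g ⟨x, h⟩ else 0, fun x hx => ?_⟩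
  refine ((hf ⟨x, hx⟩ x (Metric.mem_ball_self (hr _))).add_const
    (g ⟨x, hx⟩ - f ⟨x, hx⟩ x)).congr_of_eventuallyEq ?_
  have hx' := hg ⟨x, hx⟩
  rw [nhds_subtype_eq_comap, Filter.eventually_comap] at hx'
  filter_upwards [hx', hΩ.mem_nhds hx] with y hy hyΩ
  rw [dif_pos hyΩ, ← hy ⟨y, hyΩ⟩ rfl]
  abel

/-- At a point of differentiability, the identity `∇(axl(skew p)) = (Curl(sym p))ᵀ` says that
the rows of `p` are closed `1`-forms. -/
theorem grad_axl_skewM_eq_iff {p : V3 → M3} {x : V3}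
    (hp : ∀ i j, DifferentiableAt ℝ (fun y => p y i j) x) :
    grad (fun y => axl (skewM (p y))) x = (mCurl (fun y => symM (p y)) x)ᵀ ↔
      ∀ i j k, pd k (fun y => p y i j) x = pd j (fun y => p y i k) x := by
  have hsym (k i j : Fin 3) : pd k (fun y => symM (p y) i j) x =
      (pd k (fun y => p y i j) x + pd k (fun y => p y j i) x) / 2 := by
    have h := ((hp i j).hasFDerivAt.add (hp j i).hasFDerivAt).const_mul (1 / 2 : ℝ)
    have := congrArg (fun L => L (Pi.single k 1)) h.fderiv
    simp only [pd]
    refine Eq.trans this ?_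
    simp
    ring
  have hskew (k i j : Fin 3) : pd k (fun y => skewM (p y) i j) x =
      (pd k (fun y => p y i j) x - pd k (fun y => p y j i) x) / 2 := by
    have h := ((hp i j).hasFDerivAt.sub (hp j i).hasFDerivAt).const_mul (1 / 2 : ℝ)
    have := congrArg (fun L => L (Pi.single k 1)) h.fderiv
    simp only [pd]
    refine Eq.trans this ?_
    simp
    ring
  have haxl (k i : Fin 3) : pd k (fun y => axl (skewM (p y)) i) x =
      ![pd k (fun y => skewM (p y) 2 1) x, pd k (fun y => skewM (p y) 0 2) x,
        pd k (fun y => skewM (p y) 1 0) x] i := by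
    fin_cases i <;> rfl
  rw [← Matrix.ext_iff]
  simp only [grad, mCurl, Matrix.transpose_apply, Matrix.of_apply, haxl, hskew, hsym]
  simp only [Fin.forall_fin_succ, Fin.sum_univ_three, lc]
  have hlast (a b c : ℝ) : ![a, b, c] 2 = c := rfl
  norm_num [hlast]
  constructor
  · rintro ⟨⟨h1, h2, h3⟩, ⟨h4, h5, h6⟩, h7, h8, h9⟩
    refine ⟨⟨?_, ?_, ?_⟩, ⟨?_, ?_, ?_⟩, ?_, ?_, ?_⟩ <;> refine ⟨?_, ?_⟩ <;> linarith
  · rintro ⟨⟨h1, h2, h3⟩, ⟨h4, h5, h6⟩, h7, h8, h9⟩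
    refine ⟨⟨?_, ?_, ?_⟩, ⟨?_, ?_, ?_⟩, ?_, ?_, ?_⟩ <;> linarith

theorem ContDiffOn.two_of_hasFDerivAt {E F : Type*}
    [NormedAddCommGroup E] [NormedSpace ℝ E] [NormedAddCommGroup F] [NormedSpace ℝ F]
    {Ω : Set E} (hΩ : IsOpen Ω) {ω : E → E →L[ℝ] F} (hω : ContDiffOn ℝ 1 ω Ω) {g : E → F}
    (hg : ∀ x ∈ Ω, HasFDerivAt g (ω x) x) : ContDiffOn ℝ 2 g Ω := by
  rw [show (2 : WithTop ℕ∞) = 1 + 1 by norm_num, contDiffOn_succ_iff_fderiv_of_isOpen hΩ]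
  exact ⟨fun x hx => (hg x hx).differentiableAt.differentiableWithinAt, by simp,
    hω.congr fun x hx => (hg x hx).fderiv⟩

/-- Row `i` of a matrix field, regarded as a `1`-form. -/
def rowForm (p : V3 → M3) (i : Fin 3) (x : V3) : V3 →L[ℝ] ℝ :=
  ∑ j, p x i j • ContinuousLinearMap.proj j

theorem rowForm_apply (p : V3 → M3) (i : Fin 3) (x v : V3) :
    rowForm p i x v = ∑ j, p x i j * v j := by
  simp [rowForm]

theorem fderiv_eq_sum_pd (f : V3 → ℝ) (x v : V3) : fderiv ℝ f x v = ∑ k, v k * pd k f x := by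
  conv_lhs => rw [pi_eq_sum_univ' v]
  simp [pd, map_sum, map_smul]

theorem fderiv_rowForm_symmetric {p : V3 → M3} {i : Fin 3} {x : V3}
    (hp : ∀ j, DifferentiableAt ℝ (fun y => p y i j) x)
    (hsymm : ∀ j k, pd k (fun y => p y i j) x = pd j (fun y => p y i k) x) (a b : V3) :
    fderiv ℝ (rowForm p i) x a b = fderiv ℝ (rowForm p i) x b a := by
  have h : HasFDerivAt (rowForm p i) (∑ j, (fderiv ℝ (fun y => p y i j) x).smulRight
      (ContinuousLinearMap.proj j : V3 →L[ℝ] ℝ)) x := by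
    refine (HasFDerivAt.fun_sum fun j _ => (hp j).hasFDerivAt.smul_const
      (ContinuousLinearMap.proj j : V3 →L[ℝ] ℝ))
  rw [h.fderiv]
  simp only [_root_.sum_apply, ContinuousLinearMap.smulRight_apply,
    _root_.smul_apply, ContinuousLinearMap.proj_apply, smul_eq_mul,
    fderiv_eq_sum_pd, Finset.sum_mul]
  rw [Finset.sum_comm]
  refine Finset.sum_congr rfl fun j _ => Finset.sum_congr rfl fun k _ => ?_
  rw [hsymm k j]
  ring

/-- Symmetry of second derivatives for a `C²` function. -/
theorem pd_pd_comm {Ω : Set V3} (hΩ : IsOpen Ω) {f : V3 → ℝ} (hf : ContDiffOn ℝ 2 f Ω)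
    {x : V3} (hx : x ∈ Ω) (j k : Fin 3) :
    pd k (fun y => pd j f y) x = pd j (fun y => pd k f y) x := by
  have hfx : ContDiffAt ℝ 2 f x := hf.contDiffAt (hΩ.mem_nhds hx)
  have hd : DifferentiableAt ℝ (fderiv ℝ f) x :=
    (hfx.fderiv_right (m := 1) (by norm_num)).differentiableAt (by norm_num)
  have hpd (j k : Fin 3) : pd k (fun y => pd j f y) x =
      fderiv ℝ (fderiv ℝ f) x (Pi.single k 1) (Pi.single j 1) := by
    have := (hd.hasFDerivAt.clm_apply (hasFDerivAt_const (Pi.single j (1 : ℝ) : V3) x)).fderiv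
    simp only [pd]
    rw [this]
    simp
  rw [hpd, hpd]
  exact hfx.isSymmSndFDerivAt (by simp) _ _

/-- `∇(axl(skew p)) = (Curl(sym p))ᵀ` on `Ω` iff `p` is a gradient, for `Ω` open,
connected and simply connected and `p` of class C¹. -/
theorem compatibility_axl_skew_curl_sym (Ω : Set V3) (hΩ : IsOpen Ω)
    (hconn : IsConnected Ω) (hsc : SimplyConnectedSpace Ω)
    (p : V3 → M3) (hp : ∀ i j, ContDiffOn ℝ 1 (fun y => p y i j) Ω) :
    (∀ x ∈ Ω,
        grad (fun y => axl (skewM (p y))) x = (mCurl (fun y => symM (p y)) x)ᵀ)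
      ↔ ∃ u : V3 → V3, ContDiffOn ℝ 2 u Ω ∧ ∀ x ∈ Ω, p x = grad u x := by
  have hdiff (x : V3) (hx : x ∈ Ω) (i j : Fin 3) : DifferentiableAt ℝ (fun y => p y i j) x :=
    ((hp i j).contDiffAt (hΩ.mem_nhds hx)).differentiableAt (by norm_num)
  rw [forall₂_congr fun x hx => grad_axl_skewM_eq_iff (hdiff x hx)]
  constructor
  · intro h
    have hrow (i : Fin 3) : ContDiffOn ℝ 1 (rowForm p i) Ω :=
      ContDiffOn.sum fun j _ => (hp i j).smul contDiffOn_const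
    choose u hu using fun i => exists_hasFDerivAt_of_fderiv_symmetric_of_simplyConnected hΩ
      ((hrow i).differentiableOn (by norm_num)) fun x hx =>
        fderiv_rowForm_symmetric (hdiff x hx i) (h x hx i)
    refine ⟨fun x i => u i x, contDiffOn_pi.2 fun i => (hrow i).two_of_hasFDerivAt hΩ (hu i),
      fun x hx => ?_⟩
    ext i j
    simp [grad, pd, (hu i x hx).fderiv, rowForm_apply, Pi.single_apply]
  · rintro ⟨u, hu, hpu⟩ x hx i j k
    have hpd (j k : Fin 3) :
        pd k (fun y => p y i j) x = pd k (fun y => pd j (fun z => u z i) y) x := by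
      have : (fun y => p y i j) =ᶠ[nhds x] fun y => pd j (fun z => u z i) y := by
        filter_upwards [hΩ.mem_nhds hx] with y hy
        rw [hpu y hy]
        rfl
      rw [pd, this.fderiv_eq, ← pd]
    rw [hpd, hpd]
    exact pd_pd_comm hΩ (contDiffOn_pi.1 hu i) hx j k
end
end

section
/- First-order compatibility (matrix Poincaré lemma): let Ω ⊆ ℝ³ be an open, connected and simply connected set and let p : Ω → Matrix (Fin 3) (Fin 3) ℝ be a C¹ matrix field. Then Curl p = 0 on Ω if and only if there exists a map u : Ω → ℝ³ of class C² such that p = ∇u on Ω. -/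
open Matrix MeasureTheory

noncomputable section

section Gluing

open Topology

variable {X F : Type*} [TopologicalSpace X] [AddCommGroup F]

/-- The bundle of germs of functions that differ from the functions `f i`, defined on the open
neighbourhoods `U i` of the points `i`, by locally constant functions. -/
def germBundleCore [TopologicalSpace F] [DiscreteTopology F]
    (U : X → Set X) (hU : ∀ i, IsOpen (U i)) (hmem : ∀ i, i ∈ U i) (f : X → X → F)
    (hf : ∀ i j, ∀ x ∈ U i ∩ U j, ∀ᶠ y in 𝓝 x, f i y - f j y = f i x - f j x) :
    FiberBundleCore X X F where
  baseSet := U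
  isOpen_baseSet := hU
  indexAt := id
  mem_baseSet_at := hmem
  coordChange i j x v := v + (f i x - f j x)
  coordChange_self i x _ v := by simp
  continuousOn_coordChange i j := by
    rintro ⟨x, v⟩ ⟨hx, -⟩
    have h : ∀ᶠ q in 𝓝 (x, v), q.2 + (f i q.1 - f j q.1) = v + (f i x - f j x) := by
      have h₂ : ∀ᶠ w in 𝓝 v, w = v := by simp [nhds_discrete]
      rw [nhds_prod_eq]
      filter_upwards [(hf i j x hx).prod_mk h₂] with q hq
      rw [hq.1, hq.2]
    exact ContinuousAt.continuousWithinAt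
      (continuousAt_const.congr (h.mono fun _ hq ↦ hq.symm))
  coordChange_comp i j k x _ v := by abel

/-- On a simply connected space, functions given near every point, any two of which differ by a
locally constant function, can be corrected by constants so that they glue. -/
theorem exists_eventually_eq_add_const [SimplyConnectedSpace X] [LocallyPathConnectedSpace X]
    (U : X → Set X) (hU : ∀ i, IsOpen (U i)) (hmem : ∀ i, i ∈ U i) (f : X → X → F)
    (hf : ∀ i j, ∀ x ∈ U i ∩ U j, ∀ᶠ y in 𝓝 x, f i y - f j y = f i x - f j x) :
    ∃ g : X → F, ∀ i, ∃ c, ∀ᶠ y in 𝓝 i, g y = f i y + c := by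
  let _ : TopologicalSpace F := ⊥
  have : DiscreteTopology F := ⟨rfl⟩
  let Z := germBundleCore U hU hmem f hf
  have cov : IsCoveringMap Z.proj := FiberBundle.isCoveringMap
  obtain ⟨x₀⟩ : Nonempty X := inferInstance
  obtain ⟨s, ⟨-, hs⟩, -⟩ := cov.existsUnique_continuousMap_lifts (ContinuousMap.id X) x₀
    (⟨x₀, (0 : F)⟩ : Z.TotalSpace) rfl
  have hs' (x : X) : (s x).1 = x := congr_fun hs x
  let v (x : X) : F := (s x).2
  refine ⟨fun x ↦ f x x + v x, fun i ↦ ⟨v i, ?_⟩⟩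
  have hT (y : X) : (Z.localTriv i (s y)).2 = v y + (f y y - f i y) := by
    rw [Z.localTriv_apply]
    change v y + (f (s y).1 (s y).1 - f i (s y).1) = _
    rw [hs']
  have hi : s i ∈ (Z.localTriv i).source := by
    rw [Z.mem_localTriv_source, ← Z.baseSet_at, hs']
    exact hmem i
  have hcont : ContinuousAt (fun y ↦ (Z.localTriv i (s y)).2) i :=
    continuousAt_snd.comp
      (ContinuousAt.comp ((Z.localTriv i).continuousAt hi) s.continuous.continuousAt)
  have hev : ∀ᶠ y in 𝓝 i, (Z.localTriv i (s y)).2 = (Z.localTriv i (s i)).2 :=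
    hcont.eventually_mem ((isOpen_discrete {_}).mem_nhds rfl)
  filter_upwards [hev] with y hy
  rw [hT, hT] at hy
  have h : v i = v y + (f y y - f i y) := by rw [hy]; abel
  rw [h]
  abel

end Gluing

section Poincare

open Topology

/-- A closed `1`-form on a simply connected open set is exact. -/
theorem exists_forall_hasFDerivAt_of_fderiv_symmetric_of_simplyConnected
    {E F : Type*} [NormedAddCommGroup E] [NormedSpace ℝ E]
    [NormedAddCommGroup F] [NormedSpace ℝ F] [CompleteSpace F]
    {s : Set E} (hs : IsOpen s) [SimplyConnectedSpace s] {ω : E → E →L[ℝ] F}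
    (hω : DifferentiableOn ℝ ω s)
    (hsymm : ∀ a ∈ s, ∀ x y, fderiv ℝ ω a x y = fderiv ℝ ω a y x) :
    ∃ f : E → F, ∀ a ∈ s, HasFDerivAt f (ω a) a := by
  classical
  have : LocallyPathConnectedSpace s := hs.locallyPathConnectedSpace
  have hball (i : s) : ∃ r > 0, Metric.ball (i : E) r ⊆ s := Metric.isOpen_iff.1 hs i i.2
  choose r hr hrs using hball
  have hprim (i : s) : ∃ f : E → F, ∀ a ∈ Metric.ball (i : E) (r i), HasFDerivAt f (ω a) a :=
    (convex_ball (i : E) (r i)).exists_forall_hasFDerivAt_of_fderiv_symmetric Metric.isOpen_ball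
      (hω.mono (hrs i)) fun a ha ↦ hsymm a (hrs i ha)
  choose f hf using hprim
  obtain ⟨g, hg⟩ := exists_eventually_eq_add_const
    (fun i : s ↦ (↑) ⁻¹' Metric.ball (i : E) (r i))
    (fun i ↦ Metric.isOpen_ball.preimage continuous_subtype_val)
    (fun i ↦ Metric.mem_ball_self (hr i)) (fun i x ↦ f i x) (by
      rintro i j x ⟨hxi, hxj⟩
      let V := Metric.ball (i : E) (r i) ∩ Metric.ball (j : E) (r j)
      have hVo : IsOpen V := Metric.isOpen_ball.inter Metric.isOpen_ball
      have hVc : Convex ℝ V := (convex_ball _ _).inter (convex_ball _ _)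
      have hd (a : E) (ha : a ∈ V) : HasFDerivAt (fun y ↦ f i y - f j y) (0 : E →L[ℝ] F) a := by
        simpa using (hf i a ha.1).fun_sub (hf j a ha.2)
      filter_upwards [(hVo.preimage continuous_subtype_val).mem_nhds ⟨hxi, hxj⟩] with y hy
      exact hVc.is_const_of_fderivWithin_eq_zero
        (fun a ha ↦ (hd a ha).differentiableAt.differentiableWithinAt)
        (fun a ha ↦ by rw [fderivWithin_of_isOpen hVo ha, (hd a ha).fderiv]) hy ⟨hxi, hxj⟩)
  refine ⟨fun x ↦ if hx : x ∈ s then g ⟨x, hx⟩ else 0, fun a ha ↦ ?_⟩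
  obtain ⟨c, hc⟩ := hg ⟨a, ha⟩
  rw [nhds_subtype_eq_comap, Filter.eventually_comap] at hc
  refine ((hf ⟨a, ha⟩ a (Metric.mem_ball_self (hr _))).add_const c).congr_of_eventuallyEq ?_
  filter_upwards [hc, hs.mem_nhds ha] with y hy hys
  simpa [hys] using hy ⟨y, hys⟩ rfl

end Poincare

/-- The row-wise Curl of `P` vanishes iff the Jacobians of the rows of `P` are symmetric. -/
theorem mCurl_eq_zero_iff (P : V3 → M3) (x : V3) :
    mCurl P x = 0 ↔
      ∀ i j k, pd j (fun y => P y i k) x = pd k (fun y => P y i j) x := by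
  constructor
  · intro h i
    have h₀ := congr_fun (congr_fun h i) 0
    have h₁ := congr_fun (congr_fun h i) 1
    have h₂ := congr_fun (congr_fun h i) 2
    norm_num [mCurl, lc, Fin.sum_univ_three] at h₀ h₁ h₂
    intro j k
    fin_cases j <;> fin_cases k <;> simp only [Fin.zero_eta, Fin.mk_one, Fin.reduceFinMk] <;>
      linarith
  · intro h
    ext i j
    have h₁ := h i 0 1
    have h₂ := h i 0 2
    have h₃ := h i 1 2
    fin_cases j <;> norm_num [mCurl, lc, Fin.sum_univ_three] <;> linarith

theorem fderiv_apply_eq_sum_pd (f : V3 → ℝ) (x v : V3) :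
    fderiv ℝ f x v = ∑ j, v j * pd j f x := by
  conv_lhs => rw [pi_eq_sum_univ' v]
  simp [pd, map_sum]

/-- The `1`-form with the given coefficients. -/
def oneForm (q : Fin 3 → ℝ) : V3 →L[ℝ] ℝ := ∑ j, q j • ContinuousLinearMap.proj j

theorem oneForm_apply (q v : Fin 3 → ℝ) : oneForm q v = ∑ j, q j * v j := by
  simp [oneForm]

theorem contDiffOn_oneForm {q : V3 → Fin 3 → ℝ} {s : Set V3} {n : WithTop ℕ∞}
    (hq : ∀ j, ContDiffOn ℝ n (fun y => q y j) s) :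
    ContDiffOn ℝ n (fun y => oneForm (q y)) s :=
  ContDiffOn.sum fun j _ => (hq j).smul contDiffOn_const

theorem fderiv_oneForm_apply {q : V3 → Fin 3 → ℝ} {x : V3}
    (hq : ∀ j, DifferentiableAt ℝ (fun y => q y j) x) (v w : V3) :
    fderiv ℝ (fun y => oneForm (q y)) x v w = ∑ j, ∑ k, v k * pd k (fun y => q y j) x * w j := by
  have h : HasFDerivAt (fun y => oneForm (q y))
      (∑ j, (fderiv ℝ (fun y => q y j) x).smulRight
        (ContinuousLinearMap.proj j : V3 →L[ℝ] ℝ)) x :=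
    HasFDerivAt.fun_sum fun j _ => (hq j).hasFDerivAt.smul_const
      (ContinuousLinearMap.proj j : V3 →L[ℝ] ℝ)
  rw [h.fderiv]
  simp [fderiv_apply_eq_sum_pd, Finset.sum_mul]

/-- Matrix fields with vanishing Curl on a simply connected open set are gradients. -/
theorem exists_contDiffOn_grad_of_mCurl_eq_zero {Ω : Set V3} (hΩ : IsOpen Ω)
    [SimplyConnectedSpace Ω] {p : V3 → M3}
    (hp : ∀ i j, ContDiffOn ℝ 1 (fun y => p y i j) Ω) (hcurl : ∀ x ∈ Ω, mCurl p x = 0) :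
    ∃ u : V3 → V3, ContDiffOn ℝ 2 u Ω ∧ ∀ x ∈ Ω, p x = grad u x := by
  have hform (i : Fin 3) : ContDiffOn ℝ 1 (fun y => oneForm (p y i)) Ω :=
    contDiffOn_oneForm (hp i)
  have hprim (i : Fin 3) : ∃ f : V3 → ℝ, ∀ a ∈ Ω, HasFDerivAt f (oneForm (p a i)) a := by
    refine exists_forall_hasFDerivAt_of_fderiv_symmetric_of_simplyConnected hΩ
      ((hform i).differentiableOn one_ne_zero) fun a ha v w => ?_
    have hd (j : Fin 3) : DifferentiableAt ℝ (fun y => p y i j) a :=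
      ((hp i j).differentiableOn one_ne_zero).differentiableAt (hΩ.mem_nhds ha)
    rw [fderiv_oneForm_apply hd, fderiv_oneForm_apply hd, Finset.sum_comm]
    refine Finset.sum_congr rfl fun k _ => Finset.sum_congr rfl fun j _ => ?_
    rw [(mCurl_eq_zero_iff p a).1 (hcurl a ha) i k j]
    ring
  choose u hu using hprim
  refine ⟨fun y i => u i y, contDiffOn_pi.2 fun i => ?_, fun x hx => ?_⟩
  · rw [show (2 : WithTop ℕ∞) = 1 + 1 from one_add_one_eq_two.symm,
      contDiffOn_succ_iff_fderiv_of_isOpen hΩ]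
    exact ⟨fun a ha => (hu i a ha).differentiableAt.differentiableWithinAt, by simp,
      (hform i).congr fun a ha => (hu i a ha).fderiv⟩
  · ext i j
    simp [grad, pd, (hu i x hx).fderiv, oneForm_apply, Pi.single_apply]

/-- The Curl of the gradient of a `C²` map vanishes. -/
theorem mCurl_grad_eq_zero {u : V3 → V3} {x : V3} (hu : ContDiffAt ℝ 2 u x) :
    mCurl (grad u) x = 0 := by
  rw [mCurl_eq_zero_iff]
  intro i j k
  have hui : ContDiffAt ℝ 2 (fun y => u y i) x := contDiffAt_pi.1 hu i
  have hd : DifferentiableAt ℝ (fderiv ℝ (fun y => u y i)) x :=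
    (hui.fderiv_right (m := 1) (by norm_num)).differentiableAt one_ne_zero
  have h (a b : Fin 3) : pd a (fun y => grad u y i b) x =
      fderiv ℝ (fderiv ℝ (fun y => u y i)) x (Pi.single a 1) (Pi.single b 1) := by
    simp only [pd, grad, Matrix.of_apply]
    rw [fderiv_clm_apply hd (differentiableAt_const _)]
    simp
  rw [h, h]
  exact hui.isSymmSndFDerivAt (by simp) _ _

theorem mCurl_congr_of_eventuallyEq {P Q : V3 → M3} {x : V3} (h : P =ᶠ[nhds x] Q) :
    mCurl P x = mCurl Q x := by
  have hpd (i k l : Fin 3) : pd k (fun y => P y i l) x = pd k (fun y => Q y i l) x := by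
    rw [pd, pd, Filter.EventuallyEq.fderiv_eq (h.mono fun y hy => by rw [hy])]
  simp only [mCurl, hpd]

/-- Matrix Poincaré lemma: `Curl p = 0` on `Ω` iff `p = ∇u` on `Ω` for some `u ∈ C²`. -/
theorem matrix_poincare_lemma (Ω : Set V3) (hΩ : IsOpen Ω)
    (hconn : IsConnected Ω) (hsc : SimplyConnectedSpace Ω)
    (p : V3 → M3) (hp : ∀ i j, ContDiffOn ℝ 1 (fun y => p y i j) Ω) :
    (∀ x ∈ Ω, mCurl p x = 0) ↔
      ∃ u : V3 → V3, ContDiffOn ℝ 2 u Ω ∧ ∀ x ∈ Ω, p x = grad u x := by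
  refine ⟨exists_contDiffOn_grad_of_mCurl_eq_zero hΩ hp, ?_⟩
  rintro ⟨u, hu, hpu⟩ x hx
  have hΩx := hΩ.mem_nhds hx
  rw [mCurl_congr_of_eventuallyEq (Filter.eventually_of_mem hΩx hpu)]
  exact mCurl_grad_eq_zero (hu.contDiffAt hΩx)
end
end

section
/- Let Ω ⊆ ℝ³ be an open, connected and simply connected set and let p : Ω → Matrix (Fin 3) (Fin 3) ℝ be a C¹ matrix field. Define the incompatibility operator INC(p) = (Curl(sym p))ᵀ − ∇(axl(skew p)). Then Curl p = 0 on Ω if and only if INC(p) = 0 on Ω. -/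
open Matrix MeasureTheory

noncomputable section

theorem pd_symM {p : V3 → M3} {x : V3} (hp : ∀ i j, DifferentiableAt ℝ (fun y => p y i j) x)
    (i j k : Fin 3) :
    pd k (fun y => symM (p y) i j) x =
      (pd k (fun y => p y i j) x + pd k (fun y => p y j i) x) / 2 := by
  have h := (((hp i j).hasFDerivAt.add (hp j i).hasFDerivAt).const_mul (1 / 2)).fderiv
  have e : (fun y => symM (p y) i j) = fun y => 1 / 2 * (p y i j + p y j i) := by
    funext y
    simp [symM]
  rw [e]
  unfold pd
  erw [h]
  simp
  ring

theorem pd_skewM {p : V3 → M3} {x : V3} (hp : ∀ i j, DifferentiableAt ℝ (fun y => p y i j) x)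
    (i j k : Fin 3) :
    pd k (fun y => skewM (p y) i j) x =
      (pd k (fun y => p y i j) x - pd k (fun y => p y j i) x) / 2 := by
  have h := (((hp i j).hasFDerivAt.sub (hp j i).hasFDerivAt).const_mul (1 / 2)).fderiv
  have e : (fun y => skewM (p y) i j) = fun y => 1 / 2 * (p y i j - p y j i) := by
    funext y
    simp [skewM]
  rw [e]
  unfold pd
  erw [h]
  simp
  ring

/-- `Curl p` and `INC p` determine each other: `Curl p = (INC p)ᵀ + div (axl (skew p)) • 1`,
which is Nye's formula for the skew part. -/
theorem mCurl_eq_INC_transpose_add {p : V3 → M3} {x : V3}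
    (hp : ∀ i j, DifferentiableAt ℝ (fun y => p y i j) x) :
    mCurl p x =
      ((mCurl (fun y => symM (p y)) x)ᵀ - grad (fun y => axl (skewM (p y))) x)ᵀ +
        vdiv (fun y => axl (skewM (p y))) x • (1 : M3) := by
  ext i j
  fin_cases i <;> fin_cases j <;>
    simp [mCurl, grad, vdiv, axl, lc, Fin.sum_univ_three, pd_symM hp, pd_skewM hp] <;> ring

theorem trace_INC {p : V3 → M3} {x : V3}
    (hp : ∀ i j, DifferentiableAt ℝ (fun y => p y i j) x) :
    trace ((mCurl (fun y => symM (p y)) x)ᵀ - grad (fun y => axl (skewM (p y))) x) =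
      -vdiv (fun y => axl (skewM (p y))) x := by
  simp [trace, mCurl, grad, vdiv, axl, lc, Fin.sum_univ_three, pd_symM hp, pd_skewM hp]
  ring

/-- `Curl p = 0` on `Ω` iff `INC(p) = (Curl(sym p))ᵀ − ∇(axl(skew p)) = 0` on `Ω`. -/
theorem curl_zero_iff_INC_zero (Ω : Set V3) (hΩ : IsOpen Ω)
    (hconn : IsConnected Ω) (hsc : SimplyConnectedSpace Ω)
    (p : V3 → M3) (hp : ∀ i j, ContDiffOn ℝ 1 (fun y => p y i j) Ω) :
    (∀ x ∈ Ω, mCurl p x = 0) ↔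
      (∀ x ∈ Ω,
        (mCurl (fun y => symM (p y)) x)ᵀ - grad (fun y => axl (skewM (p y))) x = 0) := by
  refine forall₂_congr fun x hx => ?_
  have hd : ∀ i j, DifferentiableAt ℝ (fun y => p y i j) x := fun i j =>
    ((hp i j).differentiableOn one_ne_zero).differentiableAt (hΩ.mem_nhds hx)
  have hC := mCurl_eq_INC_transpose_add hd
  have hT := trace_INC hd
  set I := (mCurl (fun y => symM (p y)) x)ᵀ - grad (fun y => axl (skewM (p y))) x
  set d := vdiv (fun y => axl (skewM (p y))) x
  constructor <;> intro h
  · rw [h] at hC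
    have htr := congrArg trace hC
    simp [hT] at htr
    have hd0 : d = 0 := by linarith
    exact transpose_eq_zero.mp (by simpa [hd0] using hC.symm)
  · have hd0 : d = 0 := by simpa [h, eq_comm] using hT
    simpa [h, hd0] using hC
end
end

section
/- Let Ω ⊆ ℝ³ be open and let p : Ω → Matrix (Fin 3) (Fin 3) ℝ be a C² matrix field. Then for every x ∈ Ω the matrix Curl((Curl(sym p))ᵀ)(x) is symmetric, and the matrix Curl((Curl(skew p))ᵀ)(x) is skew-symmetric. -/
open Matrix MeasureTheory

noncomputable section

theorem differentiableAt_pd {f : V3 → ℝ} {x : V3} (hf : ContDiffAt ℝ 2 f x) (j : Fin 3) :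
    DifferentiableAt ℝ (pd j f) x :=
  ((hf.fderiv_right (m := 1) (by norm_num)).differentiableAt one_ne_zero).clm_apply
    (differentiableAt_const _)

theorem pd_pd_eq_fderiv_fderiv {f : V3 → ℝ} {x : V3} (hf : ContDiffAt ℝ 2 f x) (i j : Fin 3) :
    pd i (pd j f) x = fderiv ℝ (fderiv ℝ f) x (Pi.single i 1) (Pi.single j 1) := by
  have hd := (hf.fderiv_right (m := 1) (by norm_num)).differentiableAt one_ne_zero
  change fderiv ℝ (fun y => fderiv ℝ f y (Pi.single j 1)) x (Pi.single i 1) = _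
  rw [fderiv_clm_apply hd (differentiableAt_const _)]
  simp

/-- Partial derivatives of a `C²` function commute. -/
theorem pd_comm {f : V3 → ℝ} {x : V3} (hf : ContDiffAt ℝ 2 f x) (i j : Fin 3) :
    pd i (pd j f) x = pd j (pd i f) x := by
  rw [pd_pd_eq_fderiv_fderiv hf, pd_pd_eq_fderiv_fderiv hf]
  exact hf.isSymmSndFDerivAt (by simp) _ _

theorem pd_neg (j : Fin 3) (f : V3 → ℝ) (x : V3) : pd j (fun y => -f y) x = -pd j f x := by
  simp [pd, fderiv_fun_neg]

theorem pd_const_mul {f : V3 → ℝ} {x : V3} (hf : DifferentiableAt ℝ f x) (c : ℝ) (j : Fin 3) :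
    pd j (fun y => c * f y) x = c * pd j f x := by
  simp [pd, fderiv_const_mul hf]

theorem pd_sum {ι : Type*} {s : Finset ι} {f : ι → V3 → ℝ} {x : V3}
    (hf : ∀ a ∈ s, DifferentiableAt ℝ (f a) x) (j : Fin 3) :
    pd j (fun y => ∑ a ∈ s, f a y) x = ∑ a ∈ s, pd j (f a) x := by
  simp [pd, fderiv_fun_sum hf]

theorem mCurl_neg (P : V3 → M3) (x : V3) : mCurl (fun y => -P y) x = -mCurl P x := by
  ext i j
  simp [mCurl, pd_neg]

/-- Index form of the incompatibility operator:
`(Curl (Curl P)ᵀ)ᵢⱼ = ε j k l ε i m n ∂ₖ ∂ₘ P l n`. -/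
theorem mCurl_transpose_mCurl_apply {P : V3 → M3} {x : V3}
    (hP : ∀ i j, ContDiffAt ℝ 2 (fun y => P y i j) x) (i j : Fin 3) :
    mCurl (fun y => (mCurl P y)ᵀ) x i j =
      ∑ k, ∑ l, ∑ m, ∑ n, lc j k l * (lc i m n * pd k (pd m fun y => P y l n) x) := by
  have hd (l m n : Fin 3) :
      DifferentiableAt ℝ (fun y => lc i m n * pd m (fun z => P z l n) y) x :=
    (differentiableAt_pd (hP l n) m).const_mul _
  simp only [mCurl, of_apply, transpose_apply]
  refine Finset.sum_congr rfl fun k _ => Finset.sum_congr rfl fun l _ => ?_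
  rw [pd_sum fun m _ => DifferentiableAt.fun_sum fun n _ => hd l m n, Finset.mul_sum]
  refine Finset.sum_congr rfl fun m _ => ?_
  rw [pd_sum fun n _ => hd l m n, Finset.mul_sum]
  refine Finset.sum_congr rfl fun n _ => ?_
  rw [pd_const_mul (differentiableAt_pd (hP l n) m)]

/-- The incompatibility operator `P ↦ Curl (Curl P)ᵀ` commutes with transposition. -/
theorem transpose_mCurl_transpose_mCurl {P : V3 → M3} {x : V3}
    (hP : ∀ i j, ContDiffAt ℝ 2 (fun y => P y i j) x) :
    (mCurl (fun y => (mCurl P y)ᵀ) x)ᵀ = mCurl (fun y => (mCurl (fun z => (P z)ᵀ) y)ᵀ) x := by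
  ext i j
  rw [transpose_apply, mCurl_transpose_mCurl_apply hP,
    mCurl_transpose_mCurl_apply (P := fun z => (P z)ᵀ) fun a b => hP b a]
  have hswap (F : Fin 3 → Fin 3 → Fin 3 → Fin 3 → ℝ) :
      ∑ k, ∑ l, ∑ m, ∑ n, F k l m n = ∑ k, ∑ l, ∑ m, ∑ n, F m n k l := by
    simpa only [Fintype.sum_prod_type] using Finset.sum_comm (s := Finset.univ)
      (t := Finset.univ) (f := fun a b : Fin 3 × Fin 3 => F a.1 a.2 b.1 b.2)
  rw [hswap]
  refine Finset.sum_congr rfl fun k _ => Finset.sum_congr rfl fun l _ =>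
    Finset.sum_congr rfl fun m _ => Finset.sum_congr rfl fun n _ => ?_
  rw [pd_comm (hP n l) m k]
  exact mul_left_comm _ _ _

theorem transpose_symM (X : M3) : (symM X)ᵀ = symM X := by
  simp [symM, add_comm]

theorem transpose_skewM (X : M3) : (skewM X)ᵀ = -skewM X := by
  simp [skewM, ← smul_neg]

/-- `Curl((Curl(sym p))ᵀ)` is symmetric and `Curl((Curl(skew p))ᵀ)` is skew-symmetric on `Ω`. -/
theorem inc_symmetry_properties (Ω : Set V3) (hΩ : IsOpen Ω)
    (p : V3 → M3) (hp : ∀ i j, ContDiffOn ℝ 2 (fun y => p y i j) Ω) :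
    ∀ x ∈ Ω,
      (mCurl (fun y => (mCurl (fun z => symM (p z)) y)ᵀ) x)ᵀ
          = mCurl (fun y => (mCurl (fun z => symM (p z)) y)ᵀ) x ∧
      (mCurl (fun y => (mCurl (fun z => skewM (p z)) y)ᵀ) x)ᵀ
          = -(mCurl (fun y => (mCurl (fun z => skewM (p z)) y)ᵀ) x) := by
  intro x hx
  have hp' (i j : Fin 3) : ContDiffAt ℝ 2 (fun y => p y i j) x :=
    (hp i j).contDiffAt (hΩ.mem_nhds hx)
  constructor
  · rw [transpose_mCurl_transpose_mCurl (P := fun z => symM (p z)) fun i j =>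
      ((hp' i j).add (hp' j i)).const_smul (1 / 2 : ℝ)]
    simp only [transpose_symM]
  · rw [transpose_mCurl_transpose_mCurl (P := fun z => skewM (p z)) fun i j =>
      ((hp' i j).sub (hp' j i)).const_smul (1 / 2 : ℝ)]
    simp only [transpose_skewM, mCurl_neg, transpose_neg]
end
end

section
/- Conformal invariance of the symmetric curvature: let w, b̂ ∈ ℝ³, p̂ ∈ ℝ, let Â be a skew-symmetric 3×3 real matrix, and define φ_c : ℝ³ → ℝ³ by φ_c(x) = (1/2)·(2⟨w,x⟩·x − ‖x‖²·w) + p̂·x + Â·x + b̂. Then for every x ∈ ℝ³: ∇(curl φ_c)(x) = 2·anti(w) (a constant skew-symmetric matrix); consequently sym(∇(curl φ_c))(x) = 0, sym(Curl(sym ∇φ_c))(x) = 0, and the squared Frobenius norm ‖skew(Curl(sym ∇φ_c))(x)‖² equals ‖anti(w)‖² = 2‖w‖². -/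
open Matrix MeasureTheory

noncomputable section

/-- Infinitesimal conformal mapping
`φ_c(x) = (1/2)(2⟨w,x⟩x − ‖x‖²w) + p̂ x + Â x + b̂`. -/
def conf (w : V3) (p : ℝ) (A : M3) (b : V3) (x : V3) : V3 :=
  fun i => (1/2 : ℝ) * (2 * dot3 w x * x i - (∑ j, (x j) ^ 2) * w i)
    + p * x i + A.mulVec x i + b i

theorem hasFDerivAt_dot3 (a x : V3) :
    HasFDerivAt (dot3 a) (∑ i, a i • ContinuousLinearMap.proj (R := ℝ) (φ := fun _ => ℝ) i) x :=
  HasFDerivAt.fun_sum fun i _ => (hasFDerivAt_apply i x).const_mul (a i)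

theorem pd_dot3_add_const (j : Fin 3) (a : V3) (c : ℝ) (x : V3) :
    pd j (fun y => dot3 a y + c) x = a j := by
  rw [pd, ((hasFDerivAt_dot3 a x).add_const c).fderiv]
  simp [Pi.single_apply]

theorem pd_conf (w b : V3) (p : ℝ) (A : M3) (i j : Fin 3) (x : V3) :
    pd j (fun y => conf w p A b y i) x =
      w j * x i + (dot3 w x + p) * (1 : M3) i j - x j * w i + A i j := by
  have hx := hasFDerivAt_apply (𝕜 := ℝ) (F' := fun _ : Fin 3 => ℝ) i x
  have hsq : HasFDerivAt (fun y : V3 => ∑ k, (y k) ^ 2) _ x :=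
    HasFDerivAt.fun_sum fun k _ =>
      (hasFDerivAt_apply (𝕜 := ℝ) (F' := fun _ : Fin 3 => ℝ) k x).pow 2
  have h := ((((((hasFDerivAt_dot3 w x).const_mul 2).mul hx).sub
    (hsq.mul_const (w i))).const_mul (1 / 2)).add (hx.const_mul p)).add
    (hasFDerivAt_dot3 (A i) x) |>.add_const (b i)
  have h' : HasFDerivAt (fun y => conf w p A b y i) _ x := h
  rw [pd, h'.fderiv]
  simp only [Matrix.one_apply]
  split_ifs with hij <;> simp [Pi.single_apply, hij] <;> ring

theorem grad_conf (w b : V3) (p : ℝ) (A : M3) (x : V3) :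
    grad (conf w p A b) x =
      (dot3 w x + p) • (1 : M3) + Matrix.of (fun i j => w j * x i - x j * w i) + A := by
  ext i j
  simp only [grad, Matrix.of_apply, pd_conf, Matrix.add_apply, Matrix.smul_apply, smul_eq_mul]
  ring

theorem symM_grad_conf (w b : V3) (p : ℝ) (A : M3) (hA : Aᵀ = -A) (x : V3) :
    symM (grad (conf w p A b) x) = (dot3 w x + p) • (1 : M3) := by
  ext i j
  have h : A j i = -A i j := congrFun₂ hA i j
  have h1 : (1 : M3) j i = (1 : M3) i j := by simp [Matrix.one_apply, eq_comm]
  simp only [symM, grad_conf, Matrix.smul_apply, Matrix.add_apply, Matrix.transpose_apply,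
    Matrix.of_apply, smul_eq_mul, h, h1]
  ring

theorem vcurl_conf_apply (w b : V3) (p : ℝ) (A : M3) (x : V3) (i : Fin 3) :
    vcurl (conf w p A b) x i =
      dot3 (fun l => 2 * antiV w i l) x + ∑ j, ∑ k, lc i j k * A k j := by
  simp only [vcurl, pd_conf, antiV, dot3, lc, Matrix.of_apply]
  fin_cases i <;> simp [Fin.sum_univ_three] <;> ring

theorem grad_vcurl_conf (w b : V3) (p : ℝ) (A : M3) (x : V3) :
    grad (vcurl (conf w p A b)) x = (2 : ℝ) • antiV w := by
  ext i j
  simp only [grad, Matrix.of_apply, vcurl_conf_apply, pd_dot3_add_const, Matrix.smul_apply,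
    smul_eq_mul]

theorem mCurl_dot3_smul_one (w : V3) (p : ℝ) (x : V3) :
    mCurl (fun y => (dot3 w y + p) • (1 : M3)) x = -antiV w := by
  have h (k i l : Fin 3) :
      pd k (fun y => ((dot3 w y + p) • (1 : M3)) i l) x = w k * (1 : M3) i l := by
    simp only [Matrix.smul_apply, smul_eq_mul]
    rw [pd, (((hasFDerivAt_dot3 w x).add_const p).mul_const ((1 : M3) i l)).fderiv]
    simp [Pi.single_apply, mul_comm]
  ext i j
  simp only [mCurl, Matrix.of_apply, h, antiV, Matrix.neg_apply, neg_neg, Matrix.one_apply,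
    mul_ite, mul_one, mul_zero, Finset.sum_ite_eq, Finset.mem_univ, if_true]
  exact Finset.sum_congr rfl fun k _ => by simp only [lc]; ring

theorem transpose_antiV (v : V3) : (antiV v)ᵀ = -antiV v := by
  ext i j
  simp only [antiV, lc, Matrix.transpose_apply, Matrix.neg_apply, Matrix.of_apply,
    ← Finset.sum_neg_distrib]
  exact Finset.sum_congr rfl fun k _ => by ring

theorem symM_eq_zero {X : M3} (hX : Xᵀ = -X) : symM X = 0 := by
  simp [symM, hX]

theorem skewM_eq_self {X : M3} (hX : Xᵀ = -X) : skewM X = X := by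
  rw [skewM, hX, sub_neg_eq_add, ← two_smul ℝ X, smul_smul]
  norm_num

theorem frob2_neg (X : M3) : frob2 (-X) = frob2 X := by
  simp [frob2]

theorem frob2_antiV (v : V3) : frob2 (antiV v) = 2 * ∑ i, (v i) ^ 2 := by
  simp [frob2, antiV, lc, Fin.sum_univ_three]
  ring

/-- Conformal invariance of the symmetric curvature. -/
theorem conformal_curvature (w b : V3) (p : ℝ) (A : M3) (hA : Aᵀ = -A) :
    ∀ x : V3,
      grad (fun y => vcurl (conf w p A b) y) x = (2 : ℝ) • antiV w ∧
      symM (grad (fun y => vcurl (conf w p A b) y) x) = 0 ∧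
      symM (mCurl (fun y => symM (grad (conf w p A b) y)) x) = 0 ∧
      frob2 (skewM (mCurl (fun y => symM (grad (conf w p A b) y)) x)) = frob2 (antiV w) ∧
      frob2 (antiV w) = 2 * ∑ i, (w i) ^ 2 := by
  intro x
  have hw := transpose_antiV w
  have hCurl : mCurl (fun y => symM (grad (conf w p A b) y)) x = -antiV w := by
    simp only [symM_grad_conf w b p A hA, mCurl_dot3_smul_one]
  have hneg : (-antiV w)ᵀ = -(-antiV w) := by rw [Matrix.transpose_neg, hw]
  have hgrad := grad_vcurl_conf w b p A x
  refine ⟨hgrad, ?_, ?_, ?_, frob2_antiV w⟩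
  · exact hgrad ▸ symM_eq_zero (by rw [Matrix.transpose_smul, hw, smul_neg])
  · rw [hCurl, symM_eq_zero hneg]
  · rw [hCurl, skewM_eq_self hneg, frob2_neg]
end
end

section
/- Every second-order curvature energy in Curl(sym ∇u) arises from a third-order strain-gradient energy: for every linear map 𝕃 : Matrix (Fin 3) (Fin 3) ℝ → Matrix (Fin 3) (Fin 3) ℝ there exists a linear map 𝔅 : (Fin 3 → Fin 3 → Fin 3 → ℝ) → (Fin 3 → Fin 3 → Fin 3 → ℝ) on third-order tensors such that for every open Ω ⊆ ℝ³, every C² map u : Ω → ℝ³ and every x ∈ Ω: ⟨𝔅(η(x)), η(x)⟩ = ⟨𝕃(Curl(sym ∇u)(x)), Curl(sym ∇u)(x)⟩, where η is the third-order tensor field η_{ijk} = ∂_k (sym ∇u)_{ij} and ⟨·,·⟩ denotes the standard (componentwise) inner product on third-order tensors, respectively the Frobenius inner product on 3×3 matrices. -/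
open Matrix MeasureTheory

noncomputable section

/-- Third order tensors on `ℝ³`. -/
abbrev T3 : Type := Fin 3 → Fin 3 → Fin 3 → ℝ

/-- Componentwise inner product of third order tensors. -/
def t3inner (a b : T3) : ℝ := ∑ i, ∑ j, ∑ k, a i j k * b i j k

/-- Frobenius inner product of matrices. -/
def minner (X Y : M3) : ℝ := ∑ i, ∑ j, X i j * Y i j

/-- The linear map taking a gradient tensor `∂ₖ P i l` to the row-wise Curl of `P`. -/
def curlOfGradient : T3 →ₗ[ℝ] M3 where
  toFun a := Matrix.of fun i j => ∑ k, ∑ l, lc j k l * a i l k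
  map_add' a b := by
    ext i j
    simp [mul_add, Finset.sum_add_distrib]
  map_smul' c a := by
    ext i j
    simp [Finset.mul_sum, mul_left_comm]

/-- The adjoint of `curlOfGradient` for the componentwise inner products. -/
def curlOfGradientAdjoint : M3 →ₗ[ℝ] T3 where
  toFun X := fun i l k => ∑ j, lc j k l * X i j
  map_add' X Y := by
    ext i l k
    simp [mul_add, Finset.sum_add_distrib]
  map_smul' c X := by
    ext i l k
    simp [Finset.mul_sum, mul_left_comm]

theorem t3inner_curlOfGradientAdjoint (X : M3) (a : T3) :
    t3inner (curlOfGradientAdjoint X) a = minner X (curlOfGradient a) := by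
  simp only [t3inner, minner, curlOfGradientAdjoint, curlOfGradient, LinearMap.coe_mk,
    AddHom.coe_mk, Matrix.of_apply, Fin.sum_univ_three]
  ring

/-- Every second-order curvature energy in `Curl(sym ∇u)` arises from a third-order
strain-gradient energy. -/
theorem third_order_representation (L : M3 →ₗ[ℝ] M3) :
    ∃ B : T3 →ₗ[ℝ] T3, ∀ Ω : Set V3, IsOpen Ω → ∀ u : V3 → V3, ContDiffOn ℝ 2 u Ω →
      ∀ x ∈ Ω,
        t3inner (B (fun i j k => pd k (fun y => symM (grad u y) i j) x))
                (fun i j k => pd k (fun y => symM (grad u y) i j) x)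
          = minner (L (mCurl (fun y => symM (grad u y)) x))
                   (mCurl (fun y => symM (grad u y)) x) := by
  exact ⟨curlOfGradientAdjoint ∘ₗ L ∘ₗ curlOfGradient, fun _ _ _ _ _ _ =>
    t3inner_curlOfGradientAdjoint _ _⟩
end
end
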